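/- For any ordinal ξ, any n ∈ ℕ, and any function f : {(s,t) ∈ [𝒯_{ω^ξ}, 𝒯_{2n−1}] × MAX([𝒯_{ω^ξ}, 𝒯_{2n−1}]) : s ⪯ t} → {0,1}, there exist ε ∈ {0,1} and an extended monotone map (θ,e) from [𝒯_{ω^ξ}, 𝒯_n] into [𝒯_{ω^ξ}, 𝒯_{2n−1}] such that f(θ(s), e(t)) = ε for all s ⪯ t with t ∈ MAX([𝒯_{ω^ξ}, 𝒯_n]). -/

import Mathlib

noncomputable section
open Ordinal

/-- `s` is a proper initial segment of `t`. -/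
def SPrefix {S : Type*} (s t : List S) : Prop := s <+: t ∧ s ≠ t

/-- The maximal members of a tree of finite sequences: those with no proper extension. -/
def MaxNodes {S : Type*} (T : Set (List S)) : Set (List S) :=
  { t ∈ T | ¬ ∃ u ∈ T, SPrefix t u }

/-- A B-tree: a set of nonempty finite sequences which, together with the empty
sequence, is downward closed under the initial segment order. -/
def IsBTree {S : Type*} (T : Set (List S)) : Prop :=
  [] ∉ T ∧ ∀ s t : List S, t ∈ T → s <+: t → s ≠ [] → s ∈ T

/-- The derived tree: members having a proper extension in `T`. -/
def treeDeriv {S : Type*} (T : Set (List S)) : Set (List S) :=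
  { s ∈ T | ∃ t ∈ T, SPrefix s t }

/-- Transfinite iterates of the derivative. -/
def derivIter {S : Type*} (T : Set (List S)) (o : Ordinal.{0}) : Set (List S) :=
  Ordinal.limitRecOn o T (fun _ ih => treeDeriv ih)
    (fun o _ ih => ⋂ p : {p : Ordinal.{0} // p < o}, ih p.1 p.2)

open scoped Classical in
/-- The order `o(T)`, with value `⊤ = ∞` for ill-founded trees. -/
def treeOrder {S : Type*} (T : Set (List S)) : WithTop Ordinal :=
  if _ : ∃ o : Ordinal.{0}, derivIter T o = ∅ then
    ↑(sInf {o : Ordinal.{0} | derivIter T o = ∅}) else ⊤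

/-- A tree of finite sequences is well-founded if it has no infinite strictly
increasing chain. -/
def WellFoundedTree {S : Type*} (T : Set (List S)) : Prop :=
  ¬ ∃ c : ℕ → List S, (∀ n, c n ∈ T) ∧ ∀ n, SPrefix (c n) (c (n + 1))

/-- A monotone map from (a tree) `T` into (a tree) `V`. -/
def MonotoneTreeMap {S₁ S₂ : Type*} (θ : List S₁ → List S₂)
    (T : Set (List S₁)) (V : Set (List S₂)) : Prop :=
  Set.MapsTo θ T V ∧ ∀ s ∈ T, ∀ t ∈ T, SPrefix s t → SPrefix (θ s) (θ t)

/-- An extended monotone map `(θ, e)` from `T` into `V`. -/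
def ExtMonotoneTreeMap {S₁ S₂ : Type*} (θ e : List S₁ → List S₂)
    (T : Set (List S₁)) (V : Set (List S₂)) : Prop :=
  MonotoneTreeMap θ T V ∧ Set.MapsTo e (MaxNodes T) (MaxNodes V) ∧
    ∀ s ∈ MaxNodes T, θ s <+: e s

/-- The B-trees `𝒯_ξ` on the ordinals: `𝒯_1 = {(1)}`,
`𝒯_{ξ+1} = {(ξ+1)} ∪ {(ξ+1)⌢t : t ∈ 𝒯_ξ}`, and `𝒯_ξ = ⋃_{η<ξ} 𝒯_{η+1}` at limits. -/
def calT : Ordinal.{0} → Set (List Ordinal.{0}) := fun ξ =>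
  Ordinal.limitRecOn ξ ∅ (fun o ih => {[o + 1]} ∪ (List.cons (o + 1)) '' ih)
    (fun o _ ih => ⋃ p : {p : Ordinal.{0} // p < o}, ih p.1 p.2)

/-- The tree product `[T₀, T₁]`: concatenations of blocks `(sᵢ, xᵢ^{(|sᵢ|)})` with
`sᵢ ∈ T₀`, all but the last `sᵢ` maximal in `T₀`, and `(xᵢ)ᵢ ∈ T₁`. -/
def treeProd {S₀ S₁ : Type*} (T₀ : Set (List S₀)) (T₁ : Set (List S₁)) :
    Set (List (S₀ × S₁)) :=
  { l | ∃ (k : ℕ) (s : Fin (k + 1) → List S₀) (x : Fin (k + 1) → S₁),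
      (∀ i, s i ∈ T₀) ∧ (∀ i : Fin (k + 1), (i : ℕ) < k → s i ∈ MaxNodes T₀) ∧
      List.ofFn x ∈ T₁ ∧
      l = (List.ofFn fun i => (s i).map fun a => (a, x i)).flatten }

/-- The member `l` of `[𝒯_{ω^ξ}, 𝒯_k]` lies on the `i`-th level, i.e. its unique block
decomposition has `i` blocks; equivalently its last second coordinate is `k - i + 1`. -/
def OnLevel (k i : ℕ) (l : List (Ordinal.{0} × Ordinal.{0})) : Prop :=
  ∃ p : Ordinal.{0} × Ordinal.{0}, l.getLast? = some p ∧ p.2 = ((k - i + 1 : ℕ) : Ordinal.{0})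

/-- `U` is a unit of `[𝒯_{ω^ξ}, 𝒯_k]`: either the first level, or the set of proper
extensions on level `i+1` of some `t` maximal in the `i`-th level. -/
def IsTPUnit (ξ : Ordinal.{0}) (k : ℕ) (U : Set (List (Ordinal.{0} × Ordinal.{0}))) : Prop :=
  U = {l ∈ treeProd (calT (omega0 ^ ξ)) (calT (k : ℕ)) | OnLevel k 1 l} ∨
  ∃ (t : List (Ordinal.{0} × Ordinal.{0})) (i : ℕ), 1 ≤ i ∧ i < k ∧
    t ∈ treeProd (calT (omega0 ^ ξ)) (calT (k : ℕ)) ∧ OnLevel k i t ∧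
    (¬ ∃ u ∈ treeProd (calT (omega0 ^ ξ)) (calT (k : ℕ)), SPrefix t u ∧ OnLevel k i u) ∧
    U = {l ∈ treeProd (calT (omega0 ^ ξ)) (calT (k : ℕ)) | SPrefix t l ∧ OnLevel k (i + 1) l}



/-! natural sum -/

def nad (a b : Ordinal.{0}) : Ordinal.{0} :=
  max (⨆ x : Set.Iio a, Order.succ (nad x.1 b)) (⨆ x : Set.Iio b, Order.succ (nad a x.1))
termination_by (a, b)
decreasing_by
  · exact Prod.Lex.left _ _ x.2
  · exact Prod.Lex.right _ x.2

theorem nad_lt_left {a a' : Ordinal.{0}} (b : Ordinal.{0}) (h : a' < a) : nad a' b < nad a b := by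
  rw [nad.eq_1 a b]
  refine lt_max_of_lt_left (lt_of_lt_of_le (Order.lt_succ _) ?_)
  exact le_ciSup (f := fun x : Set.Iio a => Order.succ (nad x.1 b))
    Ordinal.bddAbove_of_small ⟨a', h⟩

theorem nad_lt_right (a : Ordinal.{0}) {b b' : Ordinal.{0}} (h : b' < b) : nad a b' < nad a b := by
  rw [nad.eq_1 a b]
  refine lt_max_of_lt_right (lt_of_lt_of_le (Order.lt_succ _) ?_)
  exact le_ciSup (f := fun x : Set.Iio b => Order.succ (nad a x.1))
    Ordinal.bddAbove_of_small ⟨b', h⟩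

theorem nad_le {a b c : Ordinal.{0}} (h1 : ∀ a' < a, nad a' b < c) (h2 : ∀ b' < b, nad a b' < c) :
    nad a b ≤ c := by
  rw [nad.eq_1 a b]
  refine max_le ?_ ?_
  · exact Ordinal.iSup_le fun x => Order.succ_le_of_lt (h1 _ x.2)
  · exact Ordinal.iSup_le fun x => Order.succ_le_of_lt (h2 _ x.2)

theorem nad_mul {Ω : Ordinal.{0}} (hp : ∀ a < Ω, ∀ b < Ω, nad a b < Ω) :
    ∀ x y : Ordinal.{0}, ∀ a b : ℕ, ∀ α < Ω, ∀ β < Ω, x = Ω * a + α → y = Ω * b + β →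
      nad x y ≤ Ω * ((a + b : ℕ) : Ordinal) + nad α β := by
  have dec : ∀ (a : ℕ) (α x' : Ordinal.{0}), α < Ω → x' < Ω * a + α →
      ∃ (m : ℕ) (r : Ordinal.{0}), r < Ω ∧ x' = Ω * m + r ∧ (m < a ∨ (m = a ∧ r < α)) := by
    intro a α x' hα hx
    have h1 : x' < Ω * ((a + 1 : ℕ) : Ordinal) := by
      push_cast
      rw [mul_add, mul_one]
      exact hx.trans (by gcongr)
    obtain ⟨q, hq, r, hr, rfl⟩ := Ordinal.lt_mul_iff.1 h1
    obtain ⟨m, rfl⟩ := Ordinal.lt_omega0.1 (hq.trans (Ordinal.natCast_lt_omega0 _))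
    refine ⟨m, r, hr, rfl, ?_⟩
    have hm : m < a + 1 := by exact_mod_cast hq
    rcases Nat.lt_succ_iff_lt_or_eq.1 hm with h | rfl
    · exact Or.inl h
    · exact Or.inr ⟨rfl, by simpa using hx⟩
  have big : ∀ (m k : ℕ) (δ ε : Ordinal.{0}), m < k → δ < Ω → Ω * (m : Ordinal) + δ < Ω * (k : Ordinal) + ε := by
    intro m k δ ε hm hδ
    calc Ω * (m : Ordinal) + δ < Ω * m + Ω := by gcongr
      _ = Ω * ((m + 1 : ℕ) : Ordinal) := by push_cast; rw [mul_add, mul_one]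
      _ ≤ Ω * k := by
        gcongr
        exact hm
      _ ≤ _ := le_self_add
  intro x
  induction x using WellFoundedLT.induction with | _ x ihx => ?_
  intro y
  induction y using WellFoundedLT.induction with | _ y ihy => ?_
  intro a b α hα β hβ hx hy
  refine nad_le ?_ ?_
  · intro x' hx'
    obtain ⟨m, r, hr, e, h⟩ := dec a α x' hα (hx ▸ hx')
    refine (ihx x' hx' y m b r hr β hβ e hy).trans_lt ?_
    rcases h with h | ⟨rfl, h⟩
    · exact big _ _ _ _ (by omega) (hp _ hr _ hβ)
    · have := nad_lt_left β h
      gcongr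
  · intro y' hy'
    obtain ⟨m, r, hr, e, h⟩ := dec b β y' hβ (hy ▸ hy')
    refine (ihy y' hy' a m α hα r hr hx e).trans_lt ?_
    rcases h with h | ⟨rfl, h⟩
    · exact big _ _ _ _ (by omega) (hp _ hα _ hr)
    · have := nad_lt_right α h
      gcongr

theorem nad_mul_lt {Ω : Ordinal.{0}} (hp : ∀ a < Ω, ∀ b < Ω, nad a b < Ω) (n : ℕ) (x y : Ordinal.{0})
    (hx : x < Ω * n) (hy : y < Ω * n) : nad x y < Ω * ((2 * n - 1 : ℕ) : Ordinal) := by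
  obtain ⟨q, hq, r, hr, rfl⟩ := Ordinal.lt_mul_iff.1 hx
  obtain ⟨m, rfl⟩ := Ordinal.lt_omega0.1 (hq.trans (Ordinal.natCast_lt_omega0 _))
  obtain ⟨q, hq', r', hr', rfl⟩ := Ordinal.lt_mul_iff.1 hy
  obtain ⟨m', rfl⟩ := Ordinal.lt_omega0.1 (hq'.trans (Ordinal.natCast_lt_omega0 _))
  have h1 : m < n := by exact_mod_cast hq
  have h2 : m' < n := by exact_mod_cast hq'
  refine (nad_mul hp _ _ m m' r hr r' hr' rfl rfl).trans_lt ?_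
  have := hp _ hr _ hr'
  calc Ω * ((m + m' : ℕ) : Ordinal) + nad r r' < Ω * ((m + m' : ℕ) : Ordinal) + Ω := by gcongr
      _ = Ω * ((m + m' + 1 : ℕ) : Ordinal) := by rw [Nat.cast_succ, mul_add, mul_one]
      _ ≤ _ := by
        gcongr
        omega

theorem nad_omega (ξ : Ordinal.{0}) : ∀ a < ω ^ ξ, ∀ b < ω ^ ξ, nad a b < ω ^ ξ := by
  induction ξ using WellFoundedLT.induction with | _ ξ ih => ?_
  intro a ha b hb
  by_cases h0 : ξ = 0
  · subst h0
    simp only [Ordinal.opow_zero, Order.lt_one_iff] at ha hb ⊢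
    subst ha hb
    exact le_antisymm (nad_le (by simp) (by simp)) (by simp)
  obtain ⟨c, hc, k, hk⟩ := (Ordinal.lt_omega0_opow h0).1 ha
  obtain ⟨c', hc', k', hk'⟩ := (Ordinal.lt_omega0_opow h0).1 hb
  have hd : max c c' < ξ := max_lt hc hc'
  have e1 : a < ω ^ (max c c') * ((max k k' : ℕ) : Ordinal) := by
    refine hk.trans_le ?_
    gcongr
    · exact omega0_pos
    · exact le_max_left _ _
    · exact le_max_left _ _
  have e2 : b < ω ^ (max c c') * ((max k k' : ℕ) : Ordinal) := by
    refine hk'.trans_le ?_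
    gcongr
    · exact omega0_pos
    · exact le_max_right _ _
    · exact le_max_right _ _
  exact (nad_mul_lt (ih _ hd) _ a b e1 e2).trans (opow_mul_lt_opow (natCast_lt_omega0 _) hd)

/-! abstract Ramsey argument -/

def lastR {S : Type*} (γ : Ordinal.{0}) (R : S → Ordinal.{0}) (l : List S) : Ordinal.{0} :=
  match l.getLast? with
  | none => γ
  | some x => R x

@[simp] theorem lastR_nil {S : Type*} (γ : Ordinal.{0}) (R : S → Ordinal.{0}) :
    lastR γ R [] = γ := rfl

@[simp] theorem lastR_append {S : Type*} (γ : Ordinal.{0}) (R : S → Ordinal.{0}) (l : List S) (x : S) :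
    lastR γ R (l ++ [x]) = R x := by simp [lastR]

theorem SPrefix.trans' {S : Type*} {a b c : List S} (h : SPrefix a b) (h' : SPrefix b c) :
    SPrefix a c := by
  refine ⟨h.1.trans h'.1, ?_⟩
  rintro rfl
  exact h.2 (h.1.eq_of_length_le h'.1.length_le)

theorem sprefix_append {S : Type*} (a b : List S) (hb : b ≠ []) : SPrefix a (a ++ b) :=
  ⟨List.prefix_append _ _, fun h => hb (by simpa using h)⟩

/-- rank-decreasing along one-step extensions -/
def StepDec {S : Type*} (γ : Ordinal.{0}) (R : S → Ordinal.{0}) (U : Set (List S)) : Prop :=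
  ∀ l x, l ++ [x] ∈ U → R x < lastR γ R l ∧ (l = [] ∨ l ∈ U)

theorem StepDec.dec {S : Type*} {γ : Ordinal.{0}} {R : S → Ordinal.{0}} {U : Set (List S)}
    (h : StepDec γ R U) : ∀ t ∈ U, ∀ s, SPrefix s t → lastR γ R t < lastR γ R s := by
  intro t
  induction t using List.reverseRecOn with
  | nil =>
    rintro _ s ⟨h1, h2⟩
    exact absurd (List.prefix_nil.1 h1) h2
  | append_singleton t x ih =>
    rintro ht s ⟨h1, h2⟩
    obtain ⟨h3, h4⟩ := h _ _ ht
    rw [lastR_append]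
    rcases List.prefix_concat_iff.1 h1 with h5 | h5
    · exact absurd h5 h2
    · by_cases h6 : s = t
      · subst h6; exact h3
      · refine h3.trans ?_
        rcases h4 with rfl | h4
        · exact absurd (List.prefix_nil.1 h5) h6
        · exact ih h4 s ⟨h5, h6⟩

open scoped Classical in
def pU {S : Type*} (r : List S → Ordinal.{0}) (F : List S → Ultrafilter (List S)) (s : List S) :
    Ultrafilter (List S) :=
  (F s).bind fun t => if _ : r t < r s then pU r F t else pure t
termination_by r s

theorem mem_ubind {α β : Type*} (f : Ultrafilter α) (m : α → Ultrafilter β) (A : Set β) :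
    A ∈ f.bind m ↔ {a | A ∈ m a} ∈ f := Iff.rfl

theorem exists_pU {S : Type*} (V : Set (List S)) (r : List S → Ordinal.{0})
    (hdec : ∀ t ∈ V, ∀ s, SPrefix s t → r t < r s)
    (hext : ∀ s, (s = [] ∨ s ∈ V) → ∀ α < r s, ∃ t ∈ V, SPrefix s t ∧ α ≤ r t)
    (h0 : r [] ≠ 0) :
    ∃ p : List S → Ultrafilter (List S), ∀ s, (s = [] ∨ s ∈ V) →
      {t | t ∈ MaxNodes V ∧ s <+: t} ∈ p s ∧
      ∀ A ∈ p s, ∀ α < r s, ∃ t ∈ V, SPrefix s t ∧ α ≤ r t ∧ A ∈ p t := by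
  classical
  have hF : ∀ s, ∃ G : Ultrafilter (List S), (s = [] ∨ s ∈ V) →
      (r s = 0 → G = pure s) ∧
      ∀ α < r s, {t | t ∈ V ∧ SPrefix s t ∧ α ≤ r t} ∈ G := by
    intro s
    by_cases hs : s = [] ∨ s ∈ V
    swap
    · exact ⟨pure s, fun h => absurd h hs⟩
    by_cases hr : r s = 0
    · exact ⟨pure s, fun _ => ⟨fun _ => rfl, fun α h => by simp [hr] at h⟩⟩
    let I := Set.Iio (r s)
    have : Nonempty I := ⟨⟨0, pos_iff_ne_zero.2 hr⟩⟩
    let L : Filter (List S) := ⨅ α : I, Filter.principal {t | t ∈ V ∧ SPrefix s t ∧ α.1 ≤ r t}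
    have hL : L.NeBot := by
      refine Filter.iInf_neBot_of_directed' ?_ ?_
      · intro a b
        refine ⟨max a b, ?_, ?_⟩
        · simp only [Filter.le_principal_iff, Filter.mem_principal]
          rintro t ⟨h1, h2, h3⟩
          exact ⟨h1, h2, le_trans (show a.1 ≤ (max a b).1 from le_max_left a b) h3⟩
        · simp only [Filter.le_principal_iff, Filter.mem_principal]
          rintro t ⟨h1, h2, h3⟩
          exact ⟨h1, h2, le_trans (show b.1 ≤ (max a b).1 from le_max_right a b) h3⟩
      · intro a
        rw [Filter.principal_neBot_iff]
        obtain ⟨t, h1, h2, h3⟩ := hext s hs a.1 a.2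
        exact ⟨t, h1, h2, h3⟩
    refine ⟨Ultrafilter.of L, fun _ => ⟨fun h => absurd h hr, fun α hα => ?_⟩⟩
    refine Ultrafilter.of_le L ?_
    exact Filter.mem_iInf_of_mem (⟨α, hα⟩ : I) (Filter.mem_principal_self _)
  choose F hF using hF
  have key : ∀ s, (s = [] ∨ s ∈ V) → r s ≠ 0 → ∀ A, (A ∈ pU r F s ↔ {t | A ∈ pU r F t} ∈ F s) := by
    intro s hs hr A
    rw [pU, mem_ubind]
    have h1 := (hF s hs).2 0 (pos_iff_ne_zero.2 hr)
    constructor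
    · intro h2
      filter_upwards [h1, h2] with t ht1 ht2
      simpa [hdec t ht1.1 s ht1.2.1] using ht2
    · intro h2
      filter_upwards [h1, h2] with t ht1 ht2
      simpa [hdec t ht1.1 s ht1.2.1] using ht2
  refine ⟨pU r F, fun s hs => ⟨?_, ?_⟩⟩
  · generalize hρ : r s = ρ
    induction ρ using WellFoundedLT.induction generalizing s with | _ ρ ih => ?_
    by_cases hr : r s = 0
    · rw [pU, (hF s hs).1 hr, mem_ubind]
      have : s ∈ V := by
        rcases hs with rfl | hs
        · exact absurd hr h0
        · exact hs
      simp [hr, MaxNodes, this]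
      intro t ht hst
      have := hdec t ht s hst
      simp [hr] at this
    · rw [key s hs hr]
      filter_upwards [(hF s hs).2 0 (pos_iff_ne_zero.2 hr)] with t ht
      have := ih (r t) (hρ ▸ hdec t ht.1 s ht.2.1) t (Or.inr ht.1) rfl
      show _ ∈ pU r F t
      filter_upwards [this] with u hu
      exact ⟨hu.1, ht.2.1.1.trans hu.2⟩
  · intro A hA α hα
    have hr : r s ≠ 0 := by rintro h; simp [h] at hα
    rw [key s hs hr] at hA
    obtain ⟨t, h1, h2⟩ := Ultrafilter.nonempty_of_mem (Filter.inter_mem hA ((hF s hs).2 α hα))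
    exact ⟨t, h2.1, h2.2.1, h2.2.2, h1⟩

def WW {S : Type*} (V : Set (List S)) (p : List S → Ultrafilter (List S))
    (B : List S → Set (List S)) (C : Set (List S))
    (s : List S) (A : Set (List S)) (γ : Ordinal.{0}) : Prop :=
  ∀ δ, δ < γ → ∃ t, t ∈ V ∧ SPrefix s t ∧ t ∈ C ∧ A ∩ B t ∈ p t ∧ WW V p B C t (A ∩ B t) δ
termination_by γ

def EE {S : Type*} (V : Set (List S)) (p : List S → Ultrafilter (List S))
    (B : List S → Set (List S)) (C : Set (List S))
    (s : List S) (A : Set (List S)) (δ : Ordinal.{0}) : Prop :=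
  ∃ t, t ∈ V ∧ SPrefix s t ∧ t ∈ C ∧ A ∩ B t ∈ p t ∧ WW V p B C t (A ∩ B t) δ

theorem WW_iff {S : Type*} {V : Set (List S)} {p : List S → Ultrafilter (List S)}
    {B : List S → Set (List S)} {C : Set (List S)}
    {s : List S} {A : Set (List S)} {γ : Ordinal.{0}} :
    WW V p B C s A γ ↔ ∀ δ < γ, EE V p B C s A δ := by
  rw [WW]; rfl

theorem WW_mono {S : Type*} {V : Set (List S)} {p : List S → Ultrafilter (List S)}
    {B : List S → Set (List S)} {C : Set (List S)} (γ : Ordinal.{0}) :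
    ∀ (s : List S) (A A' : Set (List S)), A ⊆ A' → WW V p B C s A γ → WW V p B C s A' γ := by
  induction γ using WellFoundedLT.induction with | _ γ ih => ?_
  intro s A A' hA h
  rw [WW_iff] at h ⊢
  intro δ hδ
  obtain ⟨t, h1, h2, h3, h4, h5⟩ := h δ hδ
  have : A ∩ B t ⊆ A' ∩ B t := Set.inter_subset_inter_left _ hA
  exact ⟨t, h1, h2, h3, Filter.mem_of_superset h4 this, ih δ hδ _ _ _ this h5⟩

theorem EE_mono {S : Type*} {V : Set (List S)} {p : List S → Ultrafilter (List S)}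
    {B : List S → Set (List S)} {C : Set (List S)} {γ : Ordinal.{0}}
    {s s' : List S} {A A' : Set (List S)} (hA : A ⊆ A') (hs : SPrefix s' s)
    (h : EE V p B C s A γ) : EE V p B C s' A' γ := by
  obtain ⟨t, h1, h2, h3, h4, h5⟩ := h
  have : A ∩ B t ⊆ A' ∩ B t := Set.inter_subset_inter_left _ hA
  exact ⟨t, h1, hs.trans' h2, h3, Filter.mem_of_superset h4 this, WW_mono _ _ _ _ this h5⟩

theorem EE_or {S : Type*} {V : Set (List S)} {r : List S → Ordinal.{0}}
    {p : List S → Ultrafilter (List S)}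
    {B : List S → Set (List S)} {C : Set (List S)}
    (hp : ∀ s, (s = [] ∨ s ∈ V) →
      ∀ A ∈ p s, ∀ α < r s, ∃ t ∈ V, SPrefix s t ∧ α ≤ r t ∧ A ∈ p t)
    (hB : ∀ t, B t ∈ p t) (x : Ordinal.{0}) :
    ∀ s, (s = [] ∨ s ∈ V) → ∀ A ∈ p s, ∀ δ δ', nad δ δ' = x → x < r s →
      EE V p B C s A δ ∨ EE V p B Cᶜ s A δ' := by
  induction x using WellFoundedLT.induction with | _ x ih => ?_
  intro s hs A hA δ δ' hx hr
  obtain ⟨t, h1, h2, h3, h4⟩ := hp s hs A hA x hr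
  have h5 : A ∩ B t ∈ p t := Filter.inter_mem h4 (hB t)
  by_cases hC : t ∈ C
  · by_cases hW : WW V p B C t (A ∩ B t) δ
    · exact Or.inl ⟨t, h1, h2, hC, h5, hW⟩
    · rw [WW_iff] at hW
      push Not at hW
      obtain ⟨η, hη, hE⟩ := hW
      have hlt : nad η δ' < x := hx ▸ nad_lt_left δ' hη
      rcases ih _ hlt t (Or.inr h1) _ h5 η δ' rfl (hlt.trans_le h3) with h | h
      · exact absurd h hE
      · exact Or.inr (EE_mono Set.inter_subset_left h2 h)
  · by_cases hW : WW V p B Cᶜ t (A ∩ B t) δ'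
    · exact Or.inr ⟨t, h1, h2, hC, h5, hW⟩
    · rw [WW_iff] at hW
      push Not at hW
      obtain ⟨η, hη, hE⟩ := hW
      have hlt : nad δ η < x := hx ▸ nad_lt_right δ hη
      rcases ih _ hlt t (Or.inr h1) _ h5 δ η rfl (hlt.trans_le h3) with h | h
      · exact Or.inl (EE_mono Set.inter_subset_left h2 h)
      · exact absurd h hE

theorem build {S₁ S₂ : Type*} {V : Set (List S₂)}
    {p : List S₂ → Ultrafilter (List S₂)}
    {B : List S₂ → Set (List S₂)} {C : Set (List S₂)}
    (hp : ∀ s, (s = [] ∨ s ∈ V) → {t | t ∈ MaxNodes V ∧ s <+: t} ∈ p s)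
    {U : Set (List S₁)} (hU0 : [] ∉ U) {γ : Ordinal.{0}} {R : S₁ → Ordinal.{0}} (hU : StepDec γ R U)
    (hW : WW V p B C [] Set.univ γ) :
    ∃ θ e : List S₁ → List S₂, ExtMonotoneTreeMap θ e U V ∧
      ∀ s t, s ∈ U → t ∈ MaxNodes U → s <+: t → θ s ∈ C ∧ e t ∈ B (θ s) := by
  classical
  have hstep : ∀ (st : List S₂ × Set (List S₂)) (δ : Ordinal.{0}), ∃ t, EE V p B C st.1 st.2 δ →
      t ∈ V ∧ SPrefix st.1 t ∧ t ∈ C ∧ st.2 ∩ B t ∈ p t ∧ WW V p B C t (st.2 ∩ B t) δ := by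
    intro st δ
    by_cases h : EE V p B C st.1 st.2 δ
    · obtain ⟨t, ht⟩ := h
      exact ⟨t, fun _ => ht⟩
    · exact ⟨[], fun h' => absurd h' h⟩
  choose g hg using hstep
  let st : List S₁ → List S₂ × Set (List S₂) :=
    List.foldl (fun st x => (g st (R x), st.2 ∩ B (g st (R x)))) ([], Set.univ)
  have st_app : ∀ l x, st (l ++ [x]) = (g (st l) (R x), (st l).2 ∩ B (g (st l) (R x))) := by
    intro l x
    simp [st, List.foldl_append]
  have inv : ∀ l, (l = [] ∨ l ∈ U) → WW V p B C (st l).1 (st l).2 (lastR γ R l) ∧ (l ∈ U →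
      (st l).1 ∈ V ∧ (st l).2 ∈ p (st l).1 ∧ ∀ s ∈ U, s <+: l → (st s).1 ∈ C ∧ (st l).2 ⊆ B (st s).1) ∧
      (∀ s, SPrefix s l → SPrefix (st s).1 (st l).1) := by
    intro l
    induction l using List.reverseRecOn with
    | nil =>
      intro _
      refine ⟨hW, fun h => absurd h hU0, ?_⟩
      rintro s ⟨h1, h2⟩
      exact absurd (List.prefix_nil.1 h1) h2
    | append_singleton l x ih =>
      intro hl
      have hl : l ++ [x] ∈ U := by simpa using hl
      obtain ⟨hR, hl'⟩ := hU _ _ hl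
      obtain ⟨i1, i2, i3⟩ := ih hl'
      obtain ⟨g1, g2, g3, g4, g5⟩ := hg (st l) (R x) (WW_iff.1 i1 _ hR)
      rw [st_app, lastR_append]
      refine ⟨g5, fun _ => ⟨g1, g4, ?_⟩, ?_⟩
      · intro s hs hsl
        rcases List.prefix_concat_iff.1 hsl with rfl | h
        · rw [st_app]
          exact ⟨g3, Set.inter_subset_right⟩
        · have hlU : l ∈ U := by
            rcases hl' with rfl | h'
            · rw [List.prefix_nil.1 h] at hs
              exact absurd hs hU0
            · exact h'
          obtain ⟨j1, j2⟩ := (i2 hlU).2.2 s hs h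
          exact ⟨j1, Set.inter_subset_left.trans j2⟩
      · rintro s ⟨hsl, hne⟩
        rcases List.prefix_concat_iff.1 hsl with h | h
        · exact absurd h hne
        · by_cases hs : s = l
          · subst hs; exact g2
          · exact (i3 s ⟨h, hs⟩).trans' g2
  have he : ∀ t, ∃ u, t ∈ U → u ∈ MaxNodes V ∧ (st t).1 <+: u ∧ u ∈ (st t).2 := by
    intro t
    by_cases ht : t ∈ U
    · obtain ⟨i1, i2, i3⟩ := inv t (Or.inr ht)
      obtain ⟨j1, j2, j3⟩ := i2 ht
      obtain ⟨u, hu, hu'⟩ := Ultrafilter.nonempty_of_mem (Filter.inter_mem j2 (hp _ (Or.inr j1)))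
      exact ⟨u, fun _ => ⟨hu'.1, hu'.2, hu⟩⟩
    · exact ⟨[], fun h => absurd h ht⟩
  choose e he using he
  refine ⟨fun s => (st s).1, e, ⟨⟨fun s hs => ((inv s (Or.inr hs)).2.1 hs).1, fun s _ t ht h =>
    (inv t (Or.inr ht)).2.2 s h⟩, fun s hs => (he s hs.1).1, fun s hs => (he s hs.1).2.1⟩, ?_⟩
  intro s t hs ht hst
  obtain ⟨j1, j2⟩ := ((inv t (Or.inr ht.1)).2.1 ht.1).2.2 s hs hst
  exact ⟨j1, j2 (he t ht.1).2.2⟩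

theorem ramsey {S₁ S₂ : Type*} {V : Set (List S₂)} {U : Set (List S₁)}
    {γ ρ : Ordinal.{0}} {R : S₁ → Ordinal.{0}} {R' : S₂ → Ordinal.{0}}
    (hU0 : [] ∉ U) (hU : StepDec γ R U) (hV : StepDec ρ R' V)
    (hext : ∀ s, (s = [] ∨ s ∈ V) → ∀ α < lastR ρ R' s, ∃ x, s ++ [x] ∈ V ∧ α ≤ R' x)
    (h0 : ρ ≠ 0) (hγ : ∀ a < γ, ∀ b < γ, nad a b < ρ)
    (f : List S₂ → List S₂ → Fin 2) :
    ∃ (ε : Fin 2) (θ e : List S₁ → List S₂), ExtMonotoneTreeMap θ e U V ∧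
      ∀ s t, s ∈ U → t ∈ MaxNodes U → s <+: t → f (θ s) (e t) = ε := by
  obtain ⟨p, hp⟩ := exists_pU V (lastR ρ R') hV.dec (by
    intro s hs α hα
    obtain ⟨x, h1, h2⟩ := hext s hs α hα
    exact ⟨_, h1, sprefix_append _ _ (by simp), by simpa using h2⟩) (by simpa using h0)
  have hc : ∀ t, ∃ i : Fin 2, {u | f t u = i} ∈ p t := by
    intro t
    by_cases h : {u | f t u = 0} ∈ p t
    · exact ⟨0, h⟩
    · refine ⟨1, ?_⟩
      filter_upwards [Ultrafilter.compl_mem_iff_notMem.2 h] with u hu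
      have hu : ¬ f t u = 0 := hu
      show f t u = 1
      omega
  choose c hc using hc
  let B : List S₂ → Set (List S₂) := fun t => {u | f t u = c t}
  let C : Set (List S₂) := {t | c t = 0}
  have : WW V p B C [] Set.univ γ ∨ WW V p B Cᶜ [] Set.univ γ := by
    by_contra hcon
    push Not at hcon
    rw [WW_iff, WW_iff] at hcon
    push Not at hcon
    obtain ⟨⟨a, ha, ha'⟩, ⟨b, hb, hb'⟩⟩ := hcon
    rcases EE_or (C := C) (fun s hs => (hp s hs).2) hc _ [] (Or.inl rfl) Set.univ Filter.univ_mem a b rfl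
      (by simpa using hγ a ha b hb) with h | h
    · exact ha' h
    · exact hb' h
  rcases this with h | h
  · obtain ⟨θ, e, h1, h2⟩ := build (fun s hs => (hp s hs).1) hU0 hU h
    refine ⟨0, θ, e, h1, fun s t hs ht hst => ?_⟩
    obtain ⟨h3, h4⟩ := h2 s t hs ht hst
    have h3 : c (θ s) = 0 := h3
    have h4 : f (θ s) (e t) = c (θ s) := h4
    rw [h4, h3]
  · obtain ⟨θ, e, h1, h2⟩ := build (fun s hs => (hp s hs).1) hU0 hU h
    refine ⟨1, θ, e, h1, fun s t hs ht hst => ?_⟩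
    obtain ⟨h3, h4⟩ := h2 s t hs ht hst
    have h3 : ¬ c (θ s) = 0 := h3
    have h4 : f (θ s) (e t) = c (θ s) := h4
    rw [h4]
    omega

/-! the concrete trees -/

theorem lastR_cons {S : Type*} (γ : Ordinal.{0}) (R : S → Ordinal.{0}) (x : S) (l : List S) :
    lastR γ R (x :: l) = lastR (R x) R l := by
  induction l using List.reverseRecOn with
  | nil => rfl
  | append_singleton l y _ => rw [← List.cons_append, lastR_append, lastR_append]

theorem lastR_mono {S : Type*} {γ γ' : Ordinal.{0}} (h : γ ≤ γ') (R : S → Ordinal.{0}) (l : List S) :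
    lastR γ R l ≤ lastR γ' R l := by
  induction l using List.reverseRecOn with
  | nil => exact h
  | append_singleton l y _ => simp

theorem calT_zero : calT 0 = ∅ := by simp [calT]

theorem calT_succ (o : Ordinal.{0}) : calT (o + 1) = {[o + 1]} ∪ (List.cons (o + 1)) '' calT o := by
  simp [calT]

theorem calT_limit {o : Ordinal.{0}} (h : Order.IsSuccLimit o) :
    calT o = ⋃ p : {p : Ordinal.{0} // p < o}, calT p.1 := by
  simp only [calT]
  rw [Ordinal.limitRecOn_limit _ _ _ _ h]

theorem nil_notMem_calT (o : Ordinal.{0}) : [] ∉ calT o := by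
  induction o using Ordinal.limitRecOn with
  | zero => simp [calT_zero]
  | add_one o ih => simp [calT_succ]
  | limit o h ih => simpa [calT_limit h] using ih

theorem calT_first {ξ α : Ordinal.{0}} (h : α < ξ) : ∃ ζ, α ≤ ζ ∧ [ζ + 1] ∈ calT ξ := by
  induction ξ using Ordinal.limitRecOn with
  | zero => simp at h
  | add_one o ih => exact ⟨o, Order.lt_add_one_iff.1 h, by simp [calT_succ]⟩
  | limit o ho ih =>
    refine ⟨α, le_rfl, ?_⟩
    rw [calT_limit ho]
    refine Set.mem_iUnion.2 ⟨⟨α + 1, ?_⟩, by simp [calT_succ]⟩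
    simpa using ho.succ_lt h

theorem calT_graft {ξ η : Ordinal.{0}} {l l' : List Ordinal.{0}} (h : l ++ [η + 1] ∈ calT ξ)
    (h' : l' ∈ calT η) : l ++ [η + 1] ++ l' ∈ calT ξ := by
  induction ξ using Ordinal.limitRecOn generalizing l with
  | zero => simp [calT_zero] at h
  | add_one o ih =>
    rw [calT_succ] at h ⊢
    rcases l with _ | ⟨x, l⟩
    · rcases h with h | ⟨m, hm, h⟩
      · have : η = o := by simpa using h
        subst this
        exact Or.inr ⟨l', h', rfl⟩
      · simp at h
        exact absurd (h.2 ▸ hm) (nil_notMem_calT _)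
    · rcases h with h | ⟨m, hm, h⟩
      · simp at h
      · simp at h
        obtain ⟨rfl, rfl⟩ := h
        exact Or.inr ⟨_, ih hm, by simp⟩
  | limit o ho ih =>
    rw [calT_limit ho] at h ⊢
    obtain ⟨p, hp⟩ := Set.mem_iUnion.1 h
    exact Set.mem_iUnion.2 ⟨p, ih p.1 p.2 hp⟩

theorem calT_last {ξ x : Ordinal.{0}} {l : List Ordinal.{0}} (h : l ++ [x] ∈ calT ξ) :
    ∃ η, x = η + 1 := by
  induction ξ using Ordinal.limitRecOn generalizing l with
  | zero => simp [calT_zero] at h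
  | add_one o ih =>
    rw [calT_succ] at h
    rcases l with _ | ⟨y, l⟩
    · rcases h with h | ⟨m, hm, h⟩
      · exact ⟨o, by simpa using h⟩
      · simp at h
        exact ⟨o, h.1.symm⟩
    · rcases h with h | ⟨m, hm, h⟩
      · simp at h
      · simp at h
        obtain ⟨rfl, rfl⟩ := h
        exact ih hm
  | limit o ho ih =>
    rw [calT_limit ho] at h
    obtain ⟨p, hp⟩ := Set.mem_iUnion.1 h
    exact ih p.1 p.2 hp

theorem calT_stepDec (ξ : Ordinal.{0}) : StepDec ξ Ordinal.pred (calT ξ) := by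
  induction ξ using Ordinal.limitRecOn with
  | zero => intro l x h; simp [calT_zero] at h
  | add_one o ih =>
    intro l x h
    rw [calT_succ] at h ⊢
    rcases l with _ | ⟨y, l⟩
    · have : x = o + 1 := by
        rcases h with h | ⟨m, hm, h⟩
        · simpa using h
        · simp at h
          exact h.1.symm
      subst this
      simp
    · rcases h with h | ⟨m, hm, h⟩
      · simp at h
      · simp at h
        obtain ⟨rfl, rfl⟩ := h
        obtain ⟨h1, h2⟩ := ih _ _ hm
        rw [lastR_cons, Ordinal.pred_add_one]
        refine ⟨h1, Or.inr ?_⟩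
        rcases h2 with rfl | h2
        · exact Or.inl rfl
        · exact Or.inr ⟨_, h2, rfl⟩
  | limit o ho ih =>
    intro l x h
    rw [calT_limit ho] at h ⊢
    obtain ⟨p, hp⟩ := Set.mem_iUnion.1 h
    obtain ⟨h1, h2⟩ := ih p.1 p.2 l x hp
    exact ⟨h1.trans_le (lastR_mono p.2.le _ _), h2.imp_right fun h => Set.mem_iUnion.2 ⟨p, h⟩⟩

def StepExt {S : Type*} (γ : Ordinal.{0}) (R : S → Ordinal.{0}) (V : Set (List S)) : Prop :=
  ∀ s, (s = [] ∨ s ∈ V) → ∀ α < lastR γ R s, ∃ x, s ++ [x] ∈ V ∧ α ≤ R x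

theorem calT_stepExt (ξ : Ordinal.{0}) : StepExt ξ Ordinal.pred (calT ξ) := by
  intro s hs α hα
  rcases List.eq_nil_or_concat s with rfl | ⟨l, x, rfl⟩
  · obtain ⟨ζ, h1, h2⟩ := calT_first hα
    exact ⟨_, h2, by simpa using h1⟩
  · have hs : l ++ [x] ∈ calT ξ := by simpa using hs
    obtain ⟨η, rfl⟩ := calT_last hs
    rw [List.concat_eq_append] at hα ⊢
    rw [lastR_append, Ordinal.pred_add_one] at hα
    obtain ⟨ζ, h1, h2⟩ := calT_first hα
    exact ⟨_, calT_graft hs h2, by simpa using h1⟩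

theorem maxNodes_iff {S : Type*} {γ : Ordinal.{0}} {R : S → Ordinal.{0}} {V : Set (List S)}
    (hd : StepDec γ R V) (he : StepExt γ R V) {s : List S} (hs : s ∈ V) :
    s ∈ MaxNodes V ↔ lastR γ R s = 0 := by
  constructor
  · intro h
    by_contra h0
    obtain ⟨x, h1, _⟩ := he s (Or.inr hs) 0 (pos_iff_ne_zero.2 h0)
    exact h.2 ⟨_, h1, sprefix_append _ _ (by simp)⟩
  · intro h
    refine ⟨hs, ?_⟩
    rintro ⟨u, hu, hsu⟩
    have := hd.dec u hu s hsu
    simp [h] at this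

theorem treeProd_zero {S₀ : Type*} (T₀ : Set (List S₀)) : treeProd T₀ (calT 0) = ∅ := by
  simp [treeProd, calT_zero]

theorem mem_treeProd_succ {S₀ : Type*} (T₀ : Set (List S₀)) (o : Ordinal.{0})
    (l : List (S₀ × Ordinal.{0})) :
    l ∈ treeProd T₀ (calT (o + 1)) ↔ (∃ s ∈ T₀, l = s.map fun a => (a, o + 1)) ∨
      ∃ s ∈ MaxNodes T₀, ∃ l' ∈ treeProd T₀ (calT o), l = (s.map fun a => (a, o + 1)) ++ l' := by
  constructor
  · rintro ⟨k, s, x, h1, h2, h3, rfl⟩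
    rw [calT_succ, List.ofFn_succ] at h3
    rcases h3 with h3 | ⟨m, hm, h3⟩
    · simp at h3
      obtain ⟨h3, rfl⟩ := h3
      exact Or.inl ⟨s 0, h1 0, by simp [h3]⟩
    · simp at h3
      obtain ⟨h3, rfl⟩ := h3
      rcases k with _ | k
      · simp at hm
        exact absurd hm (nil_notMem_calT _)
      · refine Or.inr ⟨s 0, h2 0 (by simp), _, ⟨k, fun i => s i.succ, fun i => x i.succ,
          fun i => h1 _, fun i hi => h2 _ (by simpa using hi), hm, rfl⟩, ?_⟩
        rw [List.ofFn_succ, List.flatten_cons, ← h3]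
  · rintro (⟨s, hs, rfl⟩ | ⟨s, hs, l', ⟨k, t, x, h1, h2, h3, rfl⟩, rfl⟩)
    · exact ⟨0, fun _ => s, fun _ => o + 1, fun _ => hs, fun i hi => by simp at hi,
        by simp [calT_succ], by simp⟩
    · refine ⟨k + 1, Fin.cons s t, Fin.cons (o + 1) x, ?_, ?_, ?_, ?_⟩
      · exact Fin.cases hs.1 h1
      · exact Fin.cases (fun _ => hs) (fun i hi => h2 i (by simpa using hi))
      · rw [List.ofFn_succ, calT_succ]
        exact Or.inr ⟨_, h3, by simp⟩
      · rw [List.ofFn_succ]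
        simp

theorem nil_notMem_treeProd {S₀ : Type*} {T₀ : Set (List S₀)} (h0 : [] ∉ T₀) (k : ℕ) :
    [] ∉ treeProd T₀ (calT (k : Ordinal)) := by
  cases k with
  | zero => simp [treeProd_zero]
  | succ k =>
    rw [Nat.cast_succ, mem_treeProd_succ]
    rintro (⟨s, hs, h⟩ | ⟨s, hs, l', _, h⟩)
    · have : s = [] := by simpa using h.symm
      exact h0 (this ▸ hs)
    · have : s = [] := by
        have := List.append_eq_nil_iff.1 h.symm
        simpa using this.1
      exact h0 (this ▸ hs.1)

def RP {S₀ : Type*} (Ω : Ordinal.{0}) (R : S₀ → Ordinal.{0}) (q : S₀ × Ordinal.{0}) : Ordinal.{0} :=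
  Ω * Ordinal.pred q.2 + R q.1

theorem lastR_RP_map {S₀ : Type*} (Ω γ o : Ordinal.{0}) (R : S₀ → Ordinal.{0}) (s : List S₀)
    (hγ : γ = Ω * o + Ω) :
    lastR γ (RP Ω R) (s.map fun a => (a, o + 1)) = Ω * o + lastR Ω R s := by
  rcases List.eq_nil_or_concat s with rfl | ⟨l, x, rfl⟩
  · simpa using hγ
  · simp [RP]

theorem lastR_append_ne {S : Type*} (γ γ' : Ordinal.{0}) (R : S → Ordinal.{0}) (l l' : List S)
    (h : l' ≠ []) : lastR γ R (l ++ l') = lastR γ' R l' := by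
  rcases List.eq_nil_or_concat l' with rfl | ⟨m, x, rfl⟩
  · exact absurd rfl h
  · rw [List.concat_eq_append, ← List.append_assoc, lastR_append, lastR_append]

theorem treeProd_stepDec {S₀ : Type*} {T₀ : Set (List S₀)} {Ω : Ordinal.{0}} {R : S₀ → Ordinal.{0}}
    (h0 : [] ∉ T₀) (hd : StepDec Ω R T₀) (he : StepExt Ω R T₀) (k : ℕ) :
    StepDec (Ω * k) (RP Ω R) (treeProd T₀ (calT (k : Ordinal))) := by
  induction k with
  | zero => intro l x h; simp [treeProd_zero] at h
  | succ k ih =>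
    have hγ : Ω * ((k + 1 : ℕ) : Ordinal) = Ω * k + Ω := by push_cast; rw [mul_add, mul_one]
    intro l q h
    rw [Nat.cast_succ, mem_treeProd_succ] at h ⊢
    rw [Nat.cast_succ] at hγ
    rcases h with ⟨s, hs, h⟩ | ⟨s, hs, l', hl', h⟩
    · rcases List.eq_nil_or_concat s with rfl | ⟨m, x, rfl⟩
      · simp at h
      rw [List.concat_eq_append] at h hs
      rw [List.map_append] at h
      obtain ⟨rfl, h⟩ := List.append_inj' h (by simp)
      obtain ⟨h1, h2⟩ := hd _ _ hs
      have : q = (x, (k : Ordinal) + 1) := by simpa using h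
      subst this
      rw [lastR_RP_map _ _ _ _ _ hγ]
      refine ⟨?_, ?_⟩
      · simp only [RP, Ordinal.pred_add_one]
        gcongr
      · rcases h2 with rfl | h2
        · simp
        · exact Or.inr (Or.inl ⟨m, h2, rfl⟩)
    · rcases List.eq_nil_or_concat l' with rfl | ⟨m, x, rfl⟩
      · exact absurd hl' (nil_notMem_treeProd h0 k)
      rw [List.concat_eq_append] at h hl'
      rw [← List.append_assoc] at h
      obtain ⟨rfl, h⟩ := List.append_inj' h (by simp)
      have : q = x := by simpa using h
      subst this
      obtain ⟨h1, h2⟩ := ih _ _ hl'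
      by_cases hm : m = []
      · subst hm
        rw [List.append_nil, lastR_RP_map _ _ _ _ _ hγ, (maxNodes_iff hd he hs.1).1 hs]
        exact ⟨by simpa using h1, Or.inr (Or.inl ⟨s, hs.1, rfl⟩)⟩
      · rw [lastR_append_ne _ (Ω * k) _ _ _ hm]
        exact ⟨h1, Or.inr (Or.inr ⟨s, hs, m, h2.resolve_left hm, rfl⟩)⟩

theorem treeProd_stepExt {S₀ : Type*} {T₀ : Set (List S₀)} {Ω : Ordinal.{0}} {R : S₀ → Ordinal.{0}}
    (h0 : [] ∉ T₀) (hd : StepDec Ω R T₀) (he : StepExt Ω R T₀) (k : ℕ) :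
    StepExt (Ω * k) (RP Ω R) (treeProd T₀ (calT (k : Ordinal))) := by
  induction k with
  | zero =>
    intro l hl α hα
    rcases hl with rfl | hl
    · simp at hα
    · simp [treeProd_zero] at hl
  | succ k ih =>
    have hγ : Ω * ((k + 1 : ℕ) : Ordinal) = Ω * k + Ω := by push_cast; rw [mul_add, mul_one]
    rw [Nat.cast_succ] at hγ ⊢
    have key : ∀ s, (s = [] ∨ s ∈ T₀) → lastR Ω R s ≠ 0 → ∀ α < Ω * k + lastR Ω R s,
        ∃ x, (s.map fun a => (a, (k : Ordinal) + 1)) ++ [x] ∈ treeProd T₀ (calT ((k : Ordinal) + 1)) ∧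
          α ≤ RP Ω R x := by
      intro s hs hne α hα
      obtain ⟨x, h1, h2⟩ := he s hs (α - Ω * k) (Ordinal.sub_lt_of_lt_add hα (pos_iff_ne_zero.2 hne))
      refine ⟨(x, (k : Ordinal) + 1), (mem_treeProd_succ _ _ _).2 (Or.inl ⟨_, h1, by simp⟩), ?_⟩
      simp only [RP, Ordinal.pred_add_one]
      exact Ordinal.sub_le.1 h2
    intro l hl α hα
    rcases hl with rfl | hl
    · have hΩ : Ω ≠ 0 := by
        rintro rfl
        simp at hα
      simpa using key [] (Or.inl rfl) (by simpa using hΩ) α (by simpa [hγ] using hα)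
    rcases (mem_treeProd_succ _ _ _).1 hl with ⟨s, hs, rfl⟩ | ⟨s, hs, l', hl', rfl⟩
    · rw [lastR_RP_map _ _ _ _ _ hγ] at hα
      by_cases hz : lastR Ω R s = 0
      · have hs' := (maxNodes_iff hd he hs).2 hz
        obtain ⟨x, h1, h2⟩ := ih [] (Or.inl rfl) α (by simpa [hz] using hα)
        exact ⟨x, (mem_treeProd_succ _ _ _).2 (Or.inr ⟨s, hs', _, h1, by simp⟩), h2⟩
      · exact key s (Or.inr hs) hz α hα
    · have hne : l' ≠ [] := by
        rintro rfl
        exact nil_notMem_treeProd h0 k hl'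
      rw [lastR_append_ne _ (Ω * k) _ _ _ hne] at hα
      obtain ⟨x, h1, h2⟩ := ih l' (Or.inr hl') α hα
      exact ⟨x, (mem_treeProd_succ _ _ _).2 (Or.inr ⟨s, hs, _, h1, by simp⟩), h2⟩

/-- for any `f` on `{(s,t) : s ⪯ t, t ∈ MAX}` of `[𝒯_{ω^ξ}, 𝒯_{2n-1}]`
with values in `{0,1}`, there are `ε` and an extended monotone map
`(θ,e) : [𝒯_{ω^ξ}, 𝒯_n] → [𝒯_{ω^ξ}, 𝒯_{2n-1}]` with `f(θ(s), e(t)) = ε` whenever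
`s ⪯ t ∈ MAX([𝒯_{ω^ξ}, 𝒯_n])`. -/
theorem statement11 (ξ : Ordinal.{0}) (n : ℕ) (hn : 0 < n)
    (f : List (Ordinal.{0} × Ordinal.{0}) → List (Ordinal.{0} × Ordinal.{0}) → Fin 2) :
    ∃ (ε : Fin 2) (θ e : List (Ordinal.{0} × Ordinal.{0}) → List (Ordinal.{0} × Ordinal.{0})),
      ExtMonotoneTreeMap θ e (treeProd (calT (omega0 ^ ξ)) (calT (n : Ordinal)))
        (treeProd (calT (omega0 ^ ξ)) (calT ((2 * n - 1 : ℕ) : Ordinal))) ∧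
      ∀ s t, s ∈ treeProd (calT (omega0 ^ ξ)) (calT (n : Ordinal)) →
        t ∈ MaxNodes (treeProd (calT (omega0 ^ ξ)) (calT (n : Ordinal))) →
        s <+: t → f (θ s) (e t) = ε := by
  have h0 := nil_notMem_calT (omega0 ^ ξ)
  have hd := calT_stepDec (omega0 ^ ξ)
  have he := calT_stepExt (omega0 ^ ξ)
  refine ramsey (nil_notMem_treeProd h0 n) (treeProd_stepDec h0 hd he n)
    (treeProd_stepDec h0 hd he (2 * n - 1)) (treeProd_stepExt h0 hd he (2 * n - 1)) ?_
    (fun a ha b hb => nad_mul_lt (nad_omega ξ) n a b ha hb) f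
  refine mul_ne_zero (Ordinal.opow_ne_zero _ omega0_ne_zero) ?_
  have : 2 * n - 1 ≠ 0 := by omega
  exact_mod_cast this
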